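/- arXiv:2412.18968 — 2 statements merged into one kernel-verified Lean document; each statement's English description precedes it below -/
import Mathlib

section
/- Under (A1) and (A2), the blow-up length ℓ(v₀) = ∫₀^∞ ds / B⁻¹(F(s+v₀) − F(v₀)) is a continuous, strictly decreasing function of v₀ ∈ (0,∞), with ℓ(v₀) → 0 as v₀ → ∞ and ℓ(v₀) → ∞ as v₀ → 0⁺. Hence ℓ : (0,∞) → (0,∞) is a bijection. -/
open Filter Set intervalIntegral MeasureTheory

section Primitive

variable {f F : ℝ → ℝ}

theorem primitive_sub (hf : ContinuousOn f (Ici 0)) (hF : ∀ x, F x = ∫ t in (0:ℝ)..x, f t)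
    {a b : ℝ} (ha : 0 ≤ a) (hb : 0 ≤ b) : F b - F a = ∫ t in a..b, f t := by
  have hint : ∀ c, 0 ≤ c → IntervalIntegrable f volume 0 c := fun c hc =>
    ContinuousOn.intervalIntegrable
      (hf.mono (by rw [uIcc_of_le hc]; exact Icc_subset_Ici_self))
  rw [hF, hF, integral_interval_sub_left (hint b hb) (hint a ha)]

theorem primitive_continuousOn (hf : ContinuousOn f (Ici 0))
    (hF : ∀ x, F x = ∫ t in (0:ℝ)..x, f t) : ContinuousOn F (Ici 0) := by
  have hg : Continuous fun t => f (max t 0) :=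
    hf.comp_continuous (continuous_id.max continuous_const) fun t => le_max_right t 0
  refine (continuous_primitive (μ := volume)
    (fun a b => hg.intervalIntegrable a b) 0).continuousOn.congr ?_
  intro x hx
  rw [hF]
  refine integral_congr fun t ht => ?_
  rw [uIcc_of_le hx] at ht
  simp [ht.1]

theorem mul_le_primitive_sub (hf : ContinuousOn f (Ici 0)) (hm : MonotoneOn f (Ici 0))
    (hF : ∀ x, F x = ∫ t in (0:ℝ)..x, f t) {x y : ℝ} (hx : 0 ≤ x) (hxy : x ≤ y) :
    f x * (y - x) ≤ F y - F x := by
  rw [primitive_sub hf hF hx (hx.trans hxy)]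
  have hsub : uIcc x y ⊆ Ici 0 := by
    rw [uIcc_of_le hxy]; exact fun t ht => hx.trans ht.1
  have := integral_mono_on hxy (intervalIntegrable_const (μ := volume) (c := f x))
    (hf.mono hsub).intervalIntegrable fun t ht => hm hx (hx.trans ht.1) ht.1
  simpa [mul_comm] using this

theorem primitive_sub_le_mul (hf : ContinuousOn f (Ici 0)) (hm : MonotoneOn f (Ici 0))
    (hF : ∀ x, F x = ∫ t in (0:ℝ)..x, f t) {x y : ℝ} (hx : 0 ≤ x) (hxy : x ≤ y) :
    F y - F x ≤ f y * (y - x) := by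
  rw [primitive_sub hf hF hx (hx.trans hxy)]
  have hsub : uIcc x y ⊆ Ici 0 := by
    rw [uIcc_of_le hxy]; exact fun t ht => hx.trans ht.1
  have := integral_mono_on hxy (hf.mono hsub).intervalIntegrable
    (intervalIntegrable_const (μ := volume) (c := f y)) fun t ht => hm (hx.trans ht.1) (hx.trans hxy) ht.2
  simpa [mul_comm] using this

theorem primitive_increment_mono (hf : ContinuousOn f (Ici 0)) (hm : MonotoneOn f (Ici 0))
    (hF : ∀ x, F x = ∫ t in (0:ℝ)..x, f t) {v w s : ℝ} (hv : 0 ≤ v) (hvw : v ≤ w)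
    (hs : 0 ≤ s) : F (s + v) - F v ≤ F (s + w) - F w := by
  have key : ∀ u, 0 ≤ u → F (s + u) - F u = ∫ t in (0:ℝ)..s, f (t + u) := fun u hu => by
    rw [primitive_sub hf hF hu (add_nonneg hs hu), integral_comp_add_right, zero_add]
  have hint : ∀ u, 0 ≤ u → IntervalIntegrable (fun t => f (t + u)) volume 0 s := fun u hu => by
    refine ContinuousOn.intervalIntegrable (hf.comp (by fun_prop) fun t ht => ?_)
    rw [uIcc_of_le hs] at ht
    exact add_nonneg ht.1 hu
  have hw := hv.trans hvw
  rw [key v hv, key w hw]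
  exact integral_mono_on hs (hint v hv) (hint w hw) fun t ht =>
    hm (add_nonneg ht.1 hv) (add_nonneg ht.1 hw) (by linarith)

theorem primitive_increment_pos (hf : ContinuousOn f (Ici 0)) (hm : MonotoneOn f (Ici 0))
    (hpos : ∀ r > (0:ℝ), 0 < f r) (hF : ∀ x, F x = ∫ t in (0:ℝ)..x, f t) {v s : ℝ}
    (hv : 0 ≤ v) (hs : 0 < s) : 0 < F (s + v) - F v := by
  have h1 := mul_le_primitive_sub hf hm hF hv (show v ≤ s / 2 + v by linarith)
  have h2 := mul_le_primitive_sub hf hm hF (show 0 ≤ s / 2 + v by linarith)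
    (show s / 2 + v ≤ s + v by linarith)
  have h3 : 0 ≤ F (s / 2 + v) - F v := by
    rw [primitive_sub hf hF hv (by linarith)]
    refine integral_nonneg (by linarith) fun t ht => ?_
    rcases (hv.trans ht.1).eq_or_lt with h | h
    · rw [← h]
      refine ge_of_tendsto ((hf 0 self_mem_Ici).mono Ioi_subset_Ici_self) ?_
      exact eventually_mem_nhdsWithin.mono fun r hr => (hpos r hr).le
    · exact (hpos t h).le
  have h4 : 0 < f (s / 2 + v) * (s + v - (s / 2 + v)) :=
    mul_pos (hpos _ (by linarith)) (by linarith)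
  linarith

end Primitive

section BlowUp

variable {f F φ : ℝ → ℝ}

theorem blowUp_integrand_continuousOn (hf : ContinuousOn f (Ici 0)) (hm : MonotoneOn f (Ici 0))
    (hpos : ∀ r > (0:ℝ), 0 < f r) (hF : ∀ x, F x = ∫ t in (0:ℝ)..x, f t)
    (hφ : ContinuousOn φ (Ioi 0)) {v : ℝ} (hv : 0 ≤ v) :
    ContinuousOn (fun s => φ (F (s + v) - F v)) (Ioi 0) := by
  refine hφ.comp (ContinuousOn.sub ?_ continuousOn_const) fun s hs =>
    primitive_increment_pos hf hm hpos hF hv hs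
  exact (primitive_continuousOn hf hF).comp (by fun_prop) fun s hs => add_nonneg (le_of_lt hs) hv

theorem blowUp_integrand_continuousOn_param (hf : ContinuousOn f (Ici 0))
    (hm : MonotoneOn f (Ici 0)) (hpos : ∀ r > (0:ℝ), 0 < f r)
    (hF : ∀ x, F x = ∫ t in (0:ℝ)..x, f t) (hφ : ContinuousOn φ (Ioi 0)) {s : ℝ} (hs : 0 < s) :
    ContinuousOn (fun v => φ (F (s + v) - F v)) (Ici 0) := by
  refine hφ.comp (ContinuousOn.sub ?_ (primitive_continuousOn hf hF)) fun v hv =>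
    primitive_increment_pos hf hm hpos hF hv hs
  exact (primitive_continuousOn hf hF).comp (by fun_prop) fun v hv => add_nonneg hs.le hv

theorem blowUp_integrand_antitone (hf : ContinuousOn f (Ici 0)) (hm : MonotoneOn f (Ici 0))
    (hpos : ∀ r > (0:ℝ), 0 < f r) (hF : ∀ x, F x = ∫ t in (0:ℝ)..x, f t)
    (hφ : AntitoneOn φ (Ioi 0)) {v w s : ℝ} (hv : 0 ≤ v) (hvw : v ≤ w) (hs : 0 < s) :
    φ (F (s + w) - F w) ≤ φ (F (s + v) - F v) :=
  hφ (primitive_increment_pos hf hm hpos hF hv hs)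
    (primitive_increment_pos hf hm hpos hF (hv.trans hvw) hs)
    (primitive_increment_mono hf hm hF hv hvw hs.le)

theorem blowUp_integrableOn_of_le (hf : ContinuousOn f (Ici 0)) (hm : MonotoneOn f (Ici 0))
    (hpos : ∀ r > (0:ℝ), 0 < f r) (hF : ∀ x, F x = ∫ t in (0:ℝ)..x, f t)
    (hφc : ContinuousOn φ (Ioi 0)) (hφ0 : ∀ t > (0:ℝ), 0 < φ t)
    {v : ℝ} (hv : 0 ≤ v) {S : Set ℝ} (hS : MeasurableSet S) (hS0 : S ⊆ Ioi 0) {g : ℝ → ℝ}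
    (hg : IntegrableOn g S) (hle : ∀ s ∈ S, φ (F (s + v) - F v) ≤ g s) :
    IntegrableOn (fun s => φ (F (s + v) - F v)) S := by
  refine Integrable.mono' hg
    (((blowUp_integrand_continuousOn hf hm hpos hF hφc hv).mono hS0).aestronglyMeasurable hS) ?_
  refine ae_restrict_of_forall_mem hS fun s hs => ?_
  rw [Real.norm_of_nonneg (hφ0 _ (primitive_increment_pos hf hm hpos hF hv (hS0 hs))).le]
  exact hle s hs

theorem blowUp_continuousOn (hf : ContinuousOn f (Ici 0)) (hm : MonotoneOn f (Ici 0))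
    (hpos : ∀ r > (0:ℝ), 0 < f r) (hF : ∀ x, F x = ∫ t in (0:ℝ)..x, f t)
    (hφc : ContinuousOn φ (Ioi 0)) (hφ0 : ∀ t > (0:ℝ), 0 < φ t) (hφ : AntitoneOn φ (Ioi 0))
    {a : ℝ} (ha : 0 ≤ a) {S : Set ℝ} (hS : MeasurableSet S) (hS0 : S ⊆ Ioi 0)
    (hint : IntegrableOn (fun s => φ (F (s + a) - F a)) S) :
    ContinuousOn (fun v => ∫ s in S, φ (F (s + v) - F v)) (Ici a) := by
  refine continuousOn_of_dominated (bound := fun s => φ (F (s + a) - F a)) ?_ ?_ hint ?_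
  · exact fun v hv => ((blowUp_integrand_continuousOn hf hm hpos hF hφc (ha.trans hv)).mono
      hS0).aestronglyMeasurable hS
  · refine fun v hv => ae_restrict_of_forall_mem hS fun s hs => ?_
    rw [Real.norm_of_nonneg
      (hφ0 _ (primitive_increment_pos hf hm hpos hF (ha.trans hv) (hS0 hs))).le]
    exact blowUp_integrand_antitone hf hm hpos hF hφ ha hv (hS0 hs)
  · exact ae_restrict_of_forall_mem hS fun s hs =>
      (blowUp_integrand_continuousOn_param hf hm hpos hF hφc (hS0 hs)).mono
        (Ici_subset_Ici.2 ha)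

theorem blowUp_integrableOn (hf : ContinuousOn f (Ici 0)) (hm : MonotoneOn f (Ici 0))
    (hpos : ∀ r > (0:ℝ), 0 < f r) (hF : ∀ x, F x = ∫ t in (0:ℝ)..x, f t)
    (hφc : ContinuousOn φ (Ioi 0)) (hφ0 : ∀ t > (0:ℝ), 0 < φ t) (hφ : AntitoneOn φ (Ioi 0))
    {C δ : ℝ} (hδ : 0 < δ) (hC : ∀ t, 0 < t → t ≤ δ → φ t ≤ C * t ^ (-(1/2) : ℝ))
    (hKO : ∀ r > (0:ℝ), IntegrableOn (fun s => φ (F s)) (Ioi r)) {v : ℝ} (hv : 0 < v) :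
    IntegrableOn (fun s => φ (F (s + v) - F v)) (Ioi 0) := by
  have hfv := hpos v hv
  have hr : 0 < δ / f v := div_pos hδ hfv
  have hF0 : F 0 = 0 := by simp [hF]
  rw [← Ioc_union_Ioi_eq_Ioi hr.le]
  refine IntegrableOn.union ?_ ?_
  · refine blowUp_integrableOn_of_le hf hm hpos hF hφc hφ0 hv.le measurableSet_Ioc
      Ioc_subset_Ioi_self (g := fun s => C * (f v) ^ (-(1/2) : ℝ) * s ^ (-(1/2) : ℝ)) ?_ ?_
    · exact Integrable.const_mul ((intervalIntegrable_iff_integrableOn_Ioc_of_le hr.le).1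
        (intervalIntegrable_rpow' (by norm_num))) _
    · intro s hs
      have hpos' : 0 < f v * s := mul_pos hfv hs.1
      have hle := mul_le_primitive_sub hf hm hF hv.le (show v ≤ s + v by linarith [hs.1])
      rw [add_sub_cancel_right] at hle
      calc φ (F (s + v) - F v) ≤ φ (f v * s) := hφ hpos' (hpos'.trans_le hle) hle
        _ ≤ C * (f v * s) ^ (-(1/2) : ℝ) :=
          hC _ hpos' (by rw [mul_comm]; exact (le_div_iff₀ hfv).1 hs.2)
        _ = _ := by rw [Real.mul_rpow hfv.le hs.1.le, mul_assoc]
  · refine blowUp_integrableOn_of_le hf hm hpos hF hφc hφ0 hv.le measurableSet_Ioi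
      (Ioi_subset_Ioi hr.le) (hKO _ hr) fun s hs => ?_
    simpa [hF0] using blowUp_integrand_antitone hf hm hpos hF hφ le_rfl hv.le (hr.trans hs)

theorem blowUp_strictAntiOn (hf : ContinuousOn f (Ici 0)) (hm : MonotoneOn f (Ici 0))
    (hpos : ∀ r > (0:ℝ), 0 < f r) (hftop : Tendsto f atTop atTop)
    (hF : ∀ x, F x = ∫ t in (0:ℝ)..x, f t) (hφ : StrictAntiOn φ (Ioi 0))
    (hint : ∀ v > (0:ℝ), IntegrableOn (fun s => φ (F (s + v) - F v)) (Ioi 0)) :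
    StrictAntiOn (fun v => ∫ s in Ioi (0:ℝ), φ (F (s + v) - F v)) (Ioi 0) := by
  intro v hv w hw hvw
  obtain ⟨s₀, hs₀⟩ := eventually_atTop.1 (hftop.eventually_gt_atTop (f w))
  have hlt : ∀ s ∈ Ioi (max s₀ 0), φ (F (s + w) - F w) < φ (F (s + v) - F v) := by
    intro s hs
    obtain ⟨h1, h2⟩ := max_lt_iff.1 (mem_Ioi.1 hs)
    refine hφ (primitive_increment_pos hf hm hpos hF (le_of_lt hv) h2)
      (primitive_increment_pos hf hm hpos hF (le_of_lt hw) h2) ?_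
    have hv' : 0 < v := hv
    have h3 := mul_le_primitive_sub hf hm hF (show 0 ≤ s + v by linarith)
      (show s + v ≤ s + w by linarith)
    have h4 := primitive_sub_le_mul hf hm hF hv'.le hvw.le
    have h5 := mul_lt_mul_of_pos_right (hs₀ (s + v) (by linarith)) (sub_pos.2 hvw)
    have h6 : s + w - (s + v) = w - v := by ring
    rw [h6] at h3
    linarith
  rw [← sub_pos, ← integral_sub (hint v hv) (hint w hw)]
  rw [setIntegral_pos_iff_support_of_nonneg_ae]
  · refine lt_of_lt_of_le ?_ (measure_mono (?_ : Ioi (max s₀ 0) ⊆ _))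
    · simp
    · exact fun s hs => ⟨(sub_pos.2 (hlt s hs)).ne', (le_max_right s₀ 0).trans_lt (mem_Ioi.1 hs)⟩
  · exact ae_restrict_of_forall_mem measurableSet_Ioi fun s hs =>
      sub_nonneg.2 (blowUp_integrand_antitone hf hm hpos hF hφ.antitoneOn (le_of_lt hv) hvw.le hs)
  · exact (hint v hv).sub (hint w hw)

theorem blowUp_tendsto_zero (hf : ContinuousOn f (Ici 0)) (hm : MonotoneOn f (Ici 0))
    (hpos : ∀ r > (0:ℝ), 0 < f r) (hftop : Tendsto f atTop atTop)
    (hF : ∀ x, F x = ∫ t in (0:ℝ)..x, f t) (hφc : ContinuousOn φ (Ioi 0))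
    (hφ0 : ∀ t > (0:ℝ), 0 < φ t) (hφ : AntitoneOn φ (Ioi 0))
    (hφtop : Tendsto φ atTop (nhds 0))
    (hint : IntegrableOn (fun s => φ (F (s + 1) - F 1)) (Ioi 0)) :
    Tendsto (fun v => ∫ s in Ioi (0:ℝ), φ (F (s + v) - F v)) atTop (nhds 0) := by
  rw [show nhds (0:ℝ) = nhds (∫ _ in Ioi (0:ℝ), (0:ℝ)) by simp]
  refine MeasureTheory.tendsto_integral_filter_of_dominated_convergence _ ?_ ?_ hint ?_
  · filter_upwards [eventually_ge_atTop 1] with v hv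
    exact (blowUp_integrand_continuousOn hf hm hpos hF hφc
      (zero_le_one.trans hv)).aestronglyMeasurable measurableSet_Ioi
  · filter_upwards [eventually_ge_atTop 1] with v hv
    refine ae_restrict_of_forall_mem measurableSet_Ioi fun s hs => ?_
    rw [Real.norm_of_nonneg
      (hφ0 _ (primitive_increment_pos hf hm hpos hF (zero_le_one.trans hv) hs)).le]
    exact blowUp_integrand_antitone hf hm hpos hF hφ zero_le_one hv hs
  · refine ae_restrict_of_forall_mem measurableSet_Ioi fun s hs => hφtop.comp ?_
    refine tendsto_atTop_mono' _ ?_ (hftop.atTop_mul_const (mem_Ioi.1 hs))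
    filter_upwards [eventually_ge_atTop 0] with v hv
    simpa using mul_le_primitive_sub hf hm hF hv (show v ≤ s + v by linarith [mem_Ioi.1 hs])

theorem blowUp_tendsto_atTop (hf : ContinuousOn f (Ici 0)) (hm : MonotoneOn f (Ici 0))
    (hpos : ∀ r > (0:ℝ), 0 < f r) (hF : ∀ x, F x = ∫ t in (0:ℝ)..x, f t)
    (hφc : ContinuousOn φ (Ioi 0)) (hφ0 : ∀ t > (0:ℝ), 0 < φ t) (hφ : AntitoneOn φ (Ioi 0))
    (hKO : ∀ r > (0:ℝ), IntegrableOn (fun s => φ (F s)) (Ioi r))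
    (hOsgood : ∀ r > (0:ℝ), ¬ IntegrableOn (fun s => φ (F s)) (Ioc 0 r))
    (hint : ∀ v > (0:ℝ), IntegrableOn (fun s => φ (F (s + v) - F v)) (Ioi 0)) :
    Tendsto (fun v => ∫ s in Ioi (0:ℝ), φ (F (s + v) - F v))
      (nhdsWithin 0 (Ioi 0)) atTop := by
  have hF0 : F 0 = 0 := by simp [hF]
  have hnn : ∀ v, 0 ≤ v → ∀ s > 0, 0 ≤ φ (F (s + v) - F v) := fun v hv s hs =>
    (hφ0 _ (primitive_increment_pos hf hm hpos hF hv hs)).le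
  have hnn0 : ∀ s > 0, 0 ≤ φ (F s) := fun s hs => by simpa [hF0] using hnn 0 le_rfl s hs
  refine tendsto_atTop.2 fun M => ?_
  by_contra hM
  refine hOsgood 1 one_pos ?_
  have hbound : ∀ ε > 0, ∫ s in Ioi ε, φ (F s) ≤ M := by
    intro ε hε
    by_contra! hlt
    refine hM ?_
    have hc := blowUp_continuousOn hf hm hpos hF hφc hφ0 hφ le_rfl measurableSet_Ioi
      (Ioi_subset_Ioi hε.le) (by simpa [hF0] using hKO ε hε) 0 self_mem_Ici
    have hev := (hc.mono Ioi_subset_Ici_self).eventually (lt_mem_nhds (a := M) (by simpa [hF0]))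
    filter_upwards [hev, self_mem_nhdsWithin] with v hMv hv
    refine hMv.le.trans (setIntegral_mono_set (hint v hv) ?_ ?_)
    · exact ae_restrict_of_forall_mem measurableSet_Ioi fun s hs => hnn v (le_of_lt hv) s hs
    · exact (Ioi_subset_Ioi hε.le).eventuallyLE
  refine integrableOn_Ioc_of_intervalIntegral_norm_bounded_left (l := atTop)
    (a := fun n : ℕ => 1 / ((n : ℝ) + 1)) (I := M) (b := 1)
    (fun n => (hKO _ Nat.one_div_pos_of_nat).mono_set Ioc_subset_Ioi_self)
    tendsto_one_div_add_atTop_nhds_zero_nat (Eventually.of_forall fun n => ?_)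
  have hn : 0 < 1 / ((n : ℝ) + 1) := Nat.one_div_pos_of_nat
  refine le_trans ?_ (hbound _ hn)
  rw [setIntegral_congr_fun measurableSet_Ioc fun s hs =>
    Real.norm_of_nonneg (hnn0 s (hn.trans hs.1))]
  exact setIntegral_mono_set (hKO _ hn)
    (ae_restrict_of_forall_mem measurableSet_Ioi fun s hs => hnn0 s (hn.trans hs))
    Ioc_subset_Ioi_self.eventuallyLE

end BlowUp

section InverseOfB

variable {A B Binv : ℝ → ℝ}

theorem weightedPrimitive_strictMonoOn (hA : Continuous (deriv A))
    (hA' : ∀ r > 0, 0 < deriv A r) (hB : ∀ x, B x = ∫ s in (0:ℝ)..x, deriv A s * s) :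
    StrictMonoOn B (Ici 0) := by
  have hc : Continuous fun s => deriv A s * s := hA.mul continuous_id
  have hd : ∀ x, HasDerivAt B (deriv A x * x) x := fun x => by
    rw [funext hB]
    exact integral_hasDerivAt_right (hc.intervalIntegrable _ _)
      (hc.stronglyMeasurableAtFilter _ _) hc.continuousAt
  refine strictMonoOn_of_deriv_pos (convex_Ici 0)
    (fun x _ => (hd x).continuousAt.continuousWithinAt) fun x hx => ?_
  rw [interior_Ici] at hx
  rw [(hd x).deriv]
  exact mul_pos (hA' x hx) hx

theorem mul_sq_le_weightedPrimitive (hA : Continuous (deriv A)) {α : ℝ}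
    (hlb : ∀ s ≥ (0:ℝ), α ≤ deriv A s) (hB : ∀ x, B x = ∫ s in (0:ℝ)..x, deriv A s * s)
    {x : ℝ} (hx : 0 ≤ x) : α * (x ^ 2 / 2) ≤ B x := by
  have hc : Continuous fun s => deriv A s * s := hA.mul continuous_id
  have := integral_mono_on hx
    ((continuous_const (y := α).mul continuous_id).intervalIntegrable (μ := volume) 0 x)
    (hc.intervalIntegrable 0 x) fun s hs => mul_le_mul_of_nonneg_right (hlb s hs.1) hs.1
  rw [hB]
  calc α * (x ^ 2 / 2) = ∫ s in (0:ℝ)..x, α * s := by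
        rw [intervalIntegral.integral_const_mul, integral_id]; ring
    _ ≤ _ := this

theorem weightedPrimitive_le_mul_sq (hA : Continuous (deriv A))
    (hB : ∀ x, B x = ∫ s in (0:ℝ)..x, deriv A s * s) :
    ∃ C > 0, ∀ x ∈ Icc (0:ℝ) 1, B x ≤ C * x ^ 2 := by
  obtain ⟨C, hC⟩ := isCompact_Icc.exists_bound_of_continuousOn (s := Icc (0:ℝ) 1) hA.continuousOn
  refine ⟨max C 1, by positivity, fun x hx => ?_⟩
  have := norm_integral_le_of_norm_le_const (a := 0) (b := x) (C := max C 1 * x)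
    (f := fun s => deriv A s * s) fun s hs => by
      rw [uIoc_of_le hx.1] at hs
      rw [norm_mul, Real.norm_of_nonneg hs.1.le]
      exact mul_le_mul ((hC s ⟨hs.1.le, hs.2.trans hx.2⟩).trans (le_max_left _ _)) hs.2 hs.1.le
        (by positivity)
  rw [← hB, sub_zero, abs_of_nonneg hx.1] at this
  calc B x ≤ _ := (le_abs_self _).trans this
    _ = _ := by ring

end InverseOfB

/-- Under (A1) and (A2), the blow-up length
`ℓ(v₀) = ∫₀^∞ ds / B⁻¹(F(s+v₀) − F(v₀))` is continuous and strictly decreasing on `(0,∞)`,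
with `ℓ(v₀) → 0` as `v₀ → ∞` and `ℓ(v₀) → ∞` as `v₀ → 0⁺`; hence `ℓ` is a bijection from
`(0,∞)` onto `(0,∞)`. -/
theorem stmt9 (A f F B Binv ℓ : ℝ → ℝ)
    (hA : ContDiff ℝ 1 A) (hAmono : Monotone A) (hA0 : A 0 = 0)
    (hA'pos : ∀ r > 0, 0 < deriv A r)
    (α : ℝ) (hα : 0 < α) (hlb : ∀ s ≥ (0:ℝ), α ≤ deriv A s)
    (hf_cont : ContinuousOn f (Set.Ici 0)) (hf_mono : MonotoneOn f (Set.Ici 0))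
    (hf0 : f 0 = 0) (hf_pos : ∀ r > (0:ℝ), 0 < f r) (hf_top : Tendsto f atTop atTop)
    (hF : ∀ x, F x = ∫ t in (0:ℝ)..x, f t)
    (hB : ∀ x, B x = ∫ s in (0:ℝ)..x, deriv A s * s)
    (hBinv_left : ∀ x ≥ (0:ℝ), Binv (B x) = x)
    (hBinv_right : ∀ t ≥ (0:ℝ), B (Binv t) = t)
    -- (A1) Keller–Osserman condition
    (hKO : ∀ r > (0:ℝ), IntegrableOn (fun s => 1 / Binv (F s)) (Set.Ioi r))
    -- (A2) Osgood condition
    (hOsgood : ∀ r > (0:ℝ), ¬ IntegrableOn (fun s => 1 / Binv (F s)) (Set.Ioc 0 r))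
    (hℓ : ∀ v₀, ℓ v₀ = ∫ s in Set.Ioi (0:ℝ), 1 / Binv (F (s + v₀) - F v₀)) :
    ContinuousOn ℓ (Set.Ioi 0) ∧ StrictAntiOn ℓ (Set.Ioi 0) ∧
      Tendsto ℓ atTop (nhds 0) ∧ Tendsto ℓ (nhdsWithin 0 (Set.Ioi 0)) atTop ∧
      Set.BijOn ℓ (Set.Ioi 0) (Set.Ioi 0) := by
  have hA' : Continuous (deriv A) := hA.continuous_deriv le_rfl
  have hBmono := weightedPrimitive_strictMonoOn hA' hA'pos hB
  have hB0 : B 0 = 0 := by simp [hB]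
  have hBcont : ContinuousOn B (Ici 0) := by
    rw [funext hB]
    exact (continuous_primitive (fun a b => (hA'.mul continuous_id).intervalIntegrable a b)
      0).continuousOn
  have hBpos : ∀ x > 0, 0 < B x := fun x hx =>
    hB0 ▸ hBmono self_mem_Ici (mem_Ici.2 (le_of_lt hx)) hx
  have hBtop : Tendsto B atTop atTop := by
    refine tendsto_atTop_mono' _ ((eventually_ge_atTop 0).mono fun x hx =>
      mul_sq_le_weightedPrimitive hA' hlb hB hx) ?_
    exact ((tendsto_pow_atTop two_ne_zero).atTop_div_const two_pos).const_mul_atTop hα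
  have hBinv_nonneg : ∀ t ≥ (0:ℝ), 0 ≤ Binv t := by
    intro t ht
    obtain ⟨K, hK0, hKt⟩ :=
      ((eventually_ge_atTop 0).and (hBtop.eventually_ge_atTop t)).exists
    obtain ⟨y, hy, rfl⟩ := intermediate_value_Icc hK0 (hBcont.mono Icc_subset_Ici_self)
      ⟨hB0.le.trans ht, hKt⟩
    rw [hBinv_left y hy.1]
    exact hy.1
  have hBinv_mono : StrictMonoOn Binv (Ici 0) := by
    intro t ht u hu htu
    by_contra! h
    have := hBmono.monotoneOn (hBinv_nonneg u hu) (hBinv_nonneg t ht) h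
    rw [hBinv_right u hu, hBinv_right t ht] at this
    exact this.not_gt htu
  have hBinv0 : Binv 0 = 0 := by simpa [hB0] using hBinv_left 0 le_rfl
  have hBinv_pos : ∀ t > (0:ℝ), 0 < Binv t := fun t ht =>
    hBinv0 ▸ hBinv_mono self_mem_Ici (mem_Ici.2 (le_of_lt ht)) ht
  have hBinv_cont : ContinuousOn Binv (Ioi 0) := by
    intro t ht
    refine (continuousAt_of_monotoneOn_of_image_mem_nhds
      (hBinv_mono.monotoneOn.mono Ioi_subset_Ici_self) (Ioi_mem_nhds ht)
      (mem_of_superset (Ioi_mem_nhds (hBinv_pos t ht)) fun x hx => ?_)).continuousWithinAt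
    exact ⟨B x, hBpos x hx, hBinv_left x (le_of_lt hx)⟩
  have hBinv_top : Tendsto Binv atTop atTop := by
    refine tendsto_atTop.2 fun K => ?_
    filter_upwards [eventually_ge_atTop (B (max K 0))] with t ht
    have hBK : 0 ≤ B (max K 0) := hB0.ge.trans
      (hBmono.monotoneOn self_mem_Ici (mem_Ici.2 (le_max_right K 0)) (le_max_right K 0))
    have := hBinv_mono.monotoneOn hBK (hBK.trans ht) ht
    rw [hBinv_left _ (le_max_right K 0)] at this
    exact (le_max_left K 0).trans this
  set φ : ℝ → ℝ := fun t => 1 / Binv t with hφdef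
  have hφc : ContinuousOn φ (Ioi 0) :=
    continuousOn_const.div hBinv_cont fun t ht => (hBinv_pos t ht).ne'
  have hφ0 : ∀ t > (0:ℝ), 0 < φ t := fun t ht => one_div_pos.2 (hBinv_pos t ht)
  have hφs : StrictAntiOn φ (Ioi 0) := fun t ht u hu htu =>
    one_div_lt_one_div_of_lt (hBinv_pos t ht)
      (hBinv_mono (Ioi_subset_Ici_self ht) (Ioi_subset_Ici_self hu) htu)
  have hφtop : Tendsto φ atTop (nhds 0) := by
    simpa [hφdef, Function.comp_def] using tendsto_inv_atTop_zero.comp hBinv_top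
  obtain ⟨C, hC0, hC⟩ := weightedPrimitive_le_mul_sq hA' hB
  have hφbound : ∀ t, 0 < t → t ≤ B 1 → φ t ≤ √C * t ^ (-(1/2) : ℝ) := by
    intro t ht ht1
    have hpos := hBinv_pos t ht
    have hle1 : Binv t ≤ 1 := by
      have := hBinv_mono.monotoneOn ht.le (ht.le.trans ht1) ht1
      rwa [hBinv_left 1 zero_le_one] at this
    have hsq := hC (Binv t) ⟨hpos.le, hle1⟩
    rw [hBinv_right t ht.le] at hsq
    have hsqrt : √t ≤ √C * Binv t := by
      rw [← Real.sqrt_sq hpos.le, ← Real.sqrt_mul hC0.le]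
      exact Real.sqrt_le_sqrt hsq
    rw [Real.rpow_neg ht.le, ← Real.sqrt_eq_rpow, ← div_eq_mul_inv, hφdef]
    dsimp only
    rw [div_le_div_iff₀ hpos (Real.sqrt_pos.2 ht), one_mul]
    exact hsqrt
  have hint : ∀ v > (0:ℝ), IntegrableOn (fun s => φ (F (s + v) - F v)) (Ioi 0) := fun v hv =>
    blowUp_integrableOn hf_cont hf_mono hf_pos hF hφc hφ0 hφs.antitoneOn (hBpos 1 one_pos)
      hφbound hKO hv
  have hℓ' : ℓ = fun v => ∫ s in Ioi (0:ℝ), φ (F (s + v) - F v) := funext hℓ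
  have hcont : ContinuousOn ℓ (Ioi 0) := by
    intro v hv
    have hv2 : 0 < v / 2 := half_pos hv
    rw [hℓ']
    exact ((blowUp_continuousOn hf_cont hf_mono hf_pos hF hφc hφ0 hφs.antitoneOn hv2.le
      measurableSet_Ioi Subset.rfl (hint _ hv2)).continuousAt
      (Ici_mem_nhds (half_lt_self hv))).continuousWithinAt
  have hanti : StrictAntiOn ℓ (Ioi 0) :=
    hℓ' ▸ blowUp_strictAntiOn hf_cont hf_mono hf_pos hf_top hF hφs hint
  have hzero : Tendsto ℓ atTop (nhds 0) :=
    hℓ' ▸ blowUp_tendsto_zero hf_cont hf_mono hf_pos hf_top hF hφc hφ0 hφs.antitoneOn hφtop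
      (hint 1 one_pos)
  have htop : Tendsto ℓ (nhdsWithin 0 (Ioi 0)) atTop :=
    hℓ' ▸ blowUp_tendsto_atTop hf_cont hf_mono hf_pos hF hφc hφ0 hφs.antitoneOn hKO hOsgood hint
  refine ⟨hcont, hanti, hzero, htop, fun v hv => ?_, hanti.injOn, fun y hy => ?_⟩
  · have hv1 : (0:ℝ) < v + 1 := add_pos hv one_pos
    refine lt_of_le_of_lt ?_ (hanti hv hv1 (lt_add_one v))
    rw [hℓ]
    exact setIntegral_nonneg measurableSet_Ioi fun s hs =>
      (hφ0 _ (primitive_increment_pos hf_cont hf_mono hf_pos hF hv1.le hs)).le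
  · have hsurj := isPreconnected_Ioi.intermediate_value_Ioi (l₁ := atTop)
      (l₂ := nhdsWithin 0 (Ioi 0)) (le_principal_iff.2 (Ioi_mem_atTop (0:ℝ))) inf_le_right
      hcont hzero htop
    exact hsurj hy
end

section
/- Under (A1) and (A2), the family of one-dimensional large solutions v_ℓ on (−ℓ,ℓ) converges to 0 uniformly on every compact subset of ℝ as ℓ → ∞. -/
open Filter Set intervalIntegral MeasureTheory

/-- A (classical) large solution of `(A(v'))' = f(v)` on the interval `(−ℓ, ℓ)`. -/
def IsLargeSol1D (A f : ℝ → ℝ) (ℓ : ℝ) (v : ℝ → ℝ) : Prop :=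
  ContDiffOn ℝ 2 v (Set.Ioo (-ℓ) ℓ) ∧
  (∀ x ∈ Set.Ioo (-ℓ) ℓ, 0 ≤ v x) ∧
  (∀ x ∈ Set.Ioo (-ℓ) ℓ, HasDerivAt (fun y => A (deriv v y)) (f (v x)) x) ∧
  Tendsto v (nhdsWithin ℓ (Set.Iio ℓ)) atTop ∧
  Tendsto v (nhdsWithin (-ℓ) (Set.Ioi (-ℓ))) atTop

theorem pos_of_forward_growth {D D' G g : ℝ → ℝ} {a b : ℝ} (hab : a ≤ b)
    (hD : ∀ x ∈ Icc a b, HasDerivAt D (D' x) x) (hG : ∀ x ∈ Icc a b, HasDerivAt G (g x) x)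
    (hg : ∀ x ∈ Icc a b, 0 < D x → 0 ≤ g x) (hGD : ∀ x ∈ Icc a b, 0 ≤ G x → 0 ≤ D' x)
    (hDa : 0 < D a) (hGa : 0 ≤ G a) : 0 < D b := by
  by_contra! hb
  have hcont : ContinuousOn D (Icc a b) := fun x hx => (hD x hx).continuousAt.continuousWithinAt
  have hclosed : IsClosed (Icc a b ∩ D ⁻¹' Iic 0) :=
    hcont.preimage_isClosed_of_isClosed isClosed_Icc isClosed_Iic
  have hbdd : BddBelow (Icc a b ∩ D ⁻¹' Iic 0) := ⟨a, fun x hx => hx.1.1⟩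
  obtain ⟨hq, hDq⟩ := hclosed.csInf_mem ⟨b, ⟨hab, le_rfl⟩, hb⟩ hbdd
  set q := sInf (Icc a b ∩ D ⁻¹' Iic 0)
  have hpos : ∀ x ∈ Ico a q, 0 < D x := fun x hx => by
    by_contra! h
    exact absurd (csInf_le hbdd ⟨⟨hx.1, hx.2.le.trans hq.2⟩, h⟩) (not_le.2 hx.2)
  have hsub : ∀ x ∈ Icc a q, x ∈ Icc a b := fun x hx => ⟨hx.1, hx.2.trans hq.2⟩
  have hGmono : MonotoneOn G (Icc a q) := by
    refine monotoneOn_of_hasDerivWithinAt_nonneg (f' := g) (convex_Icc a q)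
      (fun x hx => (hG x (hsub x hx)).continuousAt.continuousWithinAt) ?_ ?_ <;>
      rw [interior_Icc]
    · exact fun x hx => (hG x (hsub x (Ioo_subset_Icc_self hx))).hasDerivWithinAt
    · exact fun x hx => hg x (hsub x (Ioo_subset_Icc_self hx)) (hpos x ⟨hx.1.le, hx.2⟩)
  have hDmono : MonotoneOn D (Icc a q) := by
    refine monotoneOn_of_hasDerivWithinAt_nonneg (f' := D') (convex_Icc a q)
      (fun x hx => (hD x (hsub x hx)).continuousAt.continuousWithinAt) ?_ ?_ <;>
      rw [interior_Icc]
    · exact fun x hx => (hD x (hsub x (Ioo_subset_Icc_self hx))).hasDerivWithinAt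
    · exact fun x hx => hGD x (hsub x (Ioo_subset_Icc_self hx))
        (hGa.trans (hGmono ⟨le_rfl, hq.1⟩ (Ioo_subset_Icc_self hx) hx.1.le))
  have := hDmono ⟨le_rfl, hq.1⟩ ⟨hq.1, le_rfl⟩ hq.1
  have hDq' : D q ≤ 0 := hDq
  linarith

theorem pos_of_backward_growth {D D' G g : ℝ → ℝ} {a b : ℝ} (hab : a ≤ b)
    (hD : ∀ x ∈ Icc a b, HasDerivAt D (D' x) x) (hG : ∀ x ∈ Icc a b, HasDerivAt G (g x) x)
    (hg : ∀ x ∈ Icc a b, 0 < D x → 0 ≤ g x) (hGD : ∀ x ∈ Icc a b, G x ≤ 0 → D' x ≤ 0)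
    (hDb : 0 < D b) (hGb : G b ≤ 0) : 0 < D a := by
  have hmem : ∀ x ∈ Icc (-b) (-a), -x ∈ Icc a b := fun x hx =>
    ⟨by linarith [hx.2], by linarith [hx.1]⟩
  have key := pos_of_forward_growth (D := fun x => D (-x)) (D' := fun x => -D' (-x))
    (G := fun x => -G (-x)) (g := fun x => g (-x)) (neg_le_neg hab) ?_ ?_
    (fun x hx => hg _ (hmem x hx)) (fun x hx h => ?_) (by simpa using hDb) (by simpa using hGb)
  · simpa using key
  · intro x hx
    simpa [Function.comp_def] using (hD _ (hmem x hx)).comp x (hasDerivAt_neg x)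
  · intro x hx
    simpa [Function.comp_def] using ((hG _ (hmem x hx)).comp x (hasDerivAt_neg x)).fun_neg
  · have := hGD _ (hmem x hx) (by linarith)
    linarith

namespace IsLargeSol1D

variable {A f v : ℝ → ℝ} {ℓ : ℝ}

theorem hasDerivAt (h : IsLargeSol1D A f ℓ v) {x : ℝ} (hx : x ∈ Ioo (-ℓ) ℓ) :
    HasDerivAt v (deriv v x) x :=
  ((h.1.differentiableOn (by norm_num)).differentiableAt (Ioo_mem_nhds hx.1 hx.2)).hasDerivAt

theorem continuousOn_deriv (h : IsLargeSol1D A f ℓ v) : ContinuousOn (deriv v) (Ioo (-ℓ) ℓ) :=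
  h.1.continuousOn_deriv_of_isOpen isOpen_Ioo (by norm_num)

theorem exists_slope (h : IsLargeSol1D A f ℓ v) {x y : ℝ} (hx : x ∈ Ioo (-ℓ) ℓ)
    (hy : y ∈ Ioo (-ℓ) ℓ) (hxy : x < y) :
    ∃ z ∈ Ioo x y, v y - v x = deriv v z * (y - x) := by
  have hsub : ∀ t ∈ Icc x y, t ∈ Ioo (-ℓ) ℓ := fun t ht =>
    ⟨hx.1.trans_le ht.1, ht.2.trans_lt hy.2⟩
  obtain ⟨z, hz, hzeq⟩ := exists_hasDerivAt_eq_slope v (deriv v) hxy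
    (fun t ht => (h.hasDerivAt (hsub t ht)).continuousAt.continuousWithinAt)
    (fun t ht => h.hasDerivAt (hsub t (Ioo_subset_Icc_self ht)))
  refine ⟨z, hz, ?_⟩
  have : y - x ≠ 0 := (sub_pos.2 hxy).ne'
  rw [hzeq]
  field_simp

theorem exists_flux_slope (h : IsLargeSol1D A f ℓ v) {x y : ℝ} (hx : x ∈ Ioo (-ℓ) ℓ)
    (hy : y ∈ Ioo (-ℓ) ℓ) (hxy : x < y) :
    ∃ z ∈ Ioo x y, A (deriv v y) - A (deriv v x) = f (v z) * (y - x) := by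
  have hsub : ∀ t ∈ Icc x y, t ∈ Ioo (-ℓ) ℓ := fun t ht =>
    ⟨hx.1.trans_le ht.1, ht.2.trans_lt hy.2⟩
  obtain ⟨z, hz, hzeq⟩ := exists_hasDerivAt_eq_slope (fun t => A (deriv v t)) (fun t => f (v t))
    hxy (fun t ht => (h.2.2.1 t (hsub t ht)).continuousAt.continuousWithinAt)
    (fun t ht => h.2.2.1 t (hsub t (Ioo_subset_Icc_self ht)))
  refine ⟨z, hz, ?_⟩
  have : y - x ≠ 0 := (sub_pos.2 hxy).ne'
  rw [hzeq]
  field_simp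

theorem monotoneOn_flux (h : IsLargeSol1D A f ℓ v) (hf : ∀ r ≥ 0, 0 ≤ f r) :
    MonotoneOn (fun x => A (deriv v x)) (Ioo (-ℓ) ℓ) := by
  intro x hx y hy hxy
  rcases hxy.eq_or_lt with rfl | hlt
  · exact le_rfl
  obtain ⟨z, hz, hzeq⟩ := h.exists_flux_slope hx hy hlt
  have := hf _ (h.2.1 z ⟨hx.1.trans hz.1, hz.2.trans hy.2⟩)
  have := mul_nonneg this (sub_pos.2 hlt).le
  change A (deriv v x) ≤ A (deriv v y)
  linarith

theorem deriv_eq_of_flux_eq (h : IsLargeSol1D A f ℓ v) (hf : ∀ r ≥ 0, 0 ≤ f r)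
    (hf_pos : ∀ r > 0, 0 < f r) {x y : ℝ} (hx : x ∈ Ioo (-ℓ) ℓ) (hy : y ∈ Ioo (-ℓ) ℓ)
    (hA : A (deriv v x) = A (deriv v y)) : deriv v x = deriv v y := by
  wlog hxy : x < y generalizing x y
  · rcases (not_lt.1 hxy).eq_or_lt with rfl | hlt
    · rfl
    · exact (this hy hx hA.symm hlt).symm
  have hsub : ∀ t ∈ Icc x y, t ∈ Ioo (-ℓ) ℓ := fun t ht =>
    ⟨hx.1.trans_le ht.1, ht.2.trans_lt hy.2⟩
  have hmono := h.monotoneOn_flux hf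
  have hconst : ∀ t ∈ Icc x y, A (deriv v t) = A (deriv v x) := fun t ht =>
    le_antisymm ((hmono (hsub t ht) hy ht.2).trans_eq hA.symm) (hmono hx (hsub t ht) ht.1)
  have hzero : ∀ t ∈ Ioo x y, v t = 0 := by
    intro t ht
    have htm := hsub t (Ioo_subset_Icc_self ht)
    have heq : (fun s => A (deriv v s)) =ᶠ[nhds t] fun _ => A (deriv v x) := by
      filter_upwards [Ioo_mem_nhds ht.1 ht.2] with s hs
      exact hconst s (Ioo_subset_Icc_self hs)
    have hft : f (v t) = 0 :=
      (h.2.2.1 t htm).unique ((hasDerivAt_const t (A (deriv v x))).congr_of_eventuallyEq heq)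
    by_contra hne
    exact (hf_pos _ ((h.2.1 t htm).lt_of_ne' hne)).ne' hft
  have hderiv : EqOn (deriv v) (fun _ => 0) (Ioo x y) := by
    intro t ht
    have heq : v =ᶠ[nhds t] fun _ => 0 := by
      filter_upwards [Ioo_mem_nhds ht.1 ht.2] with s hs
      exact hzero s hs
    simpa using heq.deriv_eq
  have hIcc : EqOn (deriv v) (fun _ => 0) (Icc x y) :=
    hderiv.of_subset_closure (h.continuousOn_deriv.mono hsub) continuousOn_const
      Ioo_subset_Icc_self (closure_Ioo hxy.ne).ge
  rw [hIcc ⟨le_rfl, hxy.le⟩, hIcc ⟨hxy.le, le_rfl⟩]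

theorem surjOn_deriv (h : IsLargeSol1D A f ℓ v) (hℓ : 0 < ℓ) :
    SurjOn (deriv v) (Ioo (-ℓ) ℓ) univ := by
  intro r _
  have h0 : (0 : ℝ) ∈ Ioo (-ℓ) ℓ := ⟨by linarith, hℓ⟩
  have hright : ∃ z ∈ Ioo (-ℓ) ℓ, r ≤ deriv v z := by
    obtain ⟨y, hy, hy0⟩ := ((h.2.2.2.1.eventually_ge_atTop (v 0 + |r| * ℓ)).and
      (Ioo_mem_nhdsLT hℓ)).exists
    have hym : y ∈ Ioo (-ℓ) ℓ := ⟨h0.1.trans hy0.1, hy0.2⟩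
    obtain ⟨z, hz, hzeq⟩ := h.exists_slope h0 hym hy0.1
    refine ⟨z, ⟨h0.1.trans hz.1, hz.2.trans hy0.2⟩, ?_⟩
    by_contra! hlt
    have h1 : deriv v z * (y - 0) < |r| * (y - 0) :=
      mul_lt_mul_of_pos_right (hlt.trans_le (le_abs_self r)) (by linarith [hy0.1])
    have h2 : |r| * (y - 0) ≤ |r| * ℓ :=
      mul_le_mul_of_nonneg_left (by linarith [hy0.2]) (abs_nonneg r)
    linarith
  have hleft : ∃ z ∈ Ioo (-ℓ) ℓ, deriv v z ≤ r := by
    obtain ⟨y, hy, hy0⟩ := ((h.2.2.2.2.eventually_ge_atTop (v 0 + |r| * ℓ)).and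
      (Ioo_mem_nhdsGT (neg_lt_zero.2 hℓ))).exists
    have hym : y ∈ Ioo (-ℓ) ℓ := ⟨hy0.1, hy0.2.trans hℓ⟩
    obtain ⟨z, hz, hzeq⟩ := h.exists_slope hym h0 hy0.2
    refine ⟨z, ⟨hy0.1.trans hz.1, hz.2.trans hℓ⟩, ?_⟩
    by_contra! hlt
    have h1 : -|r| * (0 - y) < deriv v z * (0 - y) :=
      mul_lt_mul_of_pos_right ((neg_abs_le r).trans_lt hlt) (by linarith [hy0.2])
    have h2 : |r| * (0 - y) ≤ |r| * ℓ :=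
      mul_le_mul_of_nonneg_left (by linarith [hy0.1]) (abs_nonneg r)
    linarith
  obtain ⟨a, ha, har⟩ := hleft
  obtain ⟨b, hb, hbr⟩ := hright
  exact isPreconnected_Ioo.intermediate_value ha hb h.continuousOn_deriv ⟨har, hbr⟩

theorem strictMono_flux_function (h : IsLargeSol1D A f ℓ v) (hℓ : 0 < ℓ) (hA : Monotone A)
    (hf : ∀ r ≥ 0, 0 ≤ f r) (hf_pos : ∀ r > 0, 0 < f r) : StrictMono A := by
  refine hA.strictMono_of_injective fun r s hrs => ?_
  obtain ⟨x, hx, rfl⟩ := h.surjOn_deriv hℓ (mem_univ r)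
  obtain ⟨y, hy, rfl⟩ := h.surjOn_deriv hℓ (mem_univ s)
  exact h.deriv_eq_of_flux_eq hf hf_pos hx hy hrs

theorem monotoneOn_deriv (h : IsLargeSol1D A f ℓ v) (hA : StrictMono A)
    (hf : ∀ r ≥ 0, 0 ≤ f r) : MonotoneOn (deriv v) (Ioo (-ℓ) ℓ) :=
  fun _ hx _ hy hxy => hA.le_iff_le.1 (h.monotoneOn_flux hf hx hy hxy)

/-- Comparison of a large solution with a translated large solution on a smaller interval. -/
theorem le_of_translate_subset {k : ℝ} {u : ℝ → ℝ} (h : IsLargeSol1D A f ℓ v)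
    (hu : IsLargeSol1D A f k u) (hk : 0 < k) (hA : StrictMono A)
    (hf_mono : MonotoneOn f (Ici 0)) {c : ℝ} (hc : |c| < ℓ - k) : v c ≤ u 0 := by
  obtain ⟨hc1, hc2⟩ := abs_lt.1 hc
  by_contra! hlt
  have hmem : ∀ x ∈ Icc (-k) k, x + c ∈ Ioo (-ℓ) ℓ := fun x hx =>
    ⟨by linarith [hx.1], by linarith [hx.2]⟩
  have hD : ∀ x ∈ Ioo (-k) k, HasDerivAt (fun x => v (x + c) - u x)
      (deriv v (x + c) - deriv u x) x := fun x hx =>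
    ((h.hasDerivAt (hmem x (Ioo_subset_Icc_self hx))).comp_add_const x c).sub (hu.hasDerivAt hx)
  have hG : ∀ x ∈ Ioo (-k) k, HasDerivAt (fun x => A (deriv v (x + c)) - A (deriv u x))
      (f (v (x + c)) - f (u x)) x := fun x hx =>
    ((h.2.2.1 _ (hmem x (Ioo_subset_Icc_self hx))).comp_add_const x c).sub (hu.2.2.1 x hx)
  have hg : ∀ x ∈ Ioo (-k) k, 0 < v (x + c) - u x → 0 ≤ f (v (x + c)) - f (u x) :=
    fun x hx hpos => sub_nonneg.2 (hf_mono (hu.2.1 x hx)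
      (h.2.1 _ (hmem x (Ioo_subset_Icc_self hx))) (by linarith))
  have hcross : ∀ b ∈ Icc (-k) k, ∀ s : Set ℝ, Tendsto u (nhdsWithin b s) atTop →
      ∀ᶠ x in nhdsWithin b s, v (x + c) - u x ≤ 0 := by
    intro b hb s hs
    have hcont : ContinuousAt (fun x => v (x + c)) b :=
      ((h.hasDerivAt (hmem b hb)).comp_add_const b c).continuousAt
    filter_upwards [hs.eventually_ge_atTop (v (b + c) + 1), nhdsWithin_le_nhds
      (hcont.eventually (gt_mem_nhds (lt_add_one (v (b + c)))))] with x hx1 hx2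
    linarith
  rcases le_total 0 (A (deriv v (0 + c)) - A (deriv u 0)) with hG0 | hG0
  · obtain ⟨y, hy, hy0⟩ := ((hcross k ⟨by linarith, le_rfl⟩ _ hu.2.2.2.1).and
      (Ioo_mem_nhdsLT hk)).exists
    have hsub : ∀ x ∈ Icc 0 y, x ∈ Ioo (-k) k := fun x hx =>
      ⟨by linarith [hx.1], hx.2.trans_lt hy0.2⟩
    refine hy.not_gt (pos_of_forward_growth (D := fun x => v (x + c) - u x)
      hy0.1.le (fun x hx => hD x (hsub x hx))
      (fun x hx => hG x (hsub x hx)) (fun x hx => hg x (hsub x hx)) (fun x _ hx => ?_)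
      (by simpa using hlt) hG0)
    exact sub_nonneg.2 (hA.le_iff_le.1 (sub_nonneg.1 hx))
  · obtain ⟨y, hy, hy0⟩ := ((hcross (-k) ⟨le_rfl, by linarith⟩ _ hu.2.2.2.2).and
      (Ioo_mem_nhdsGT (neg_lt_zero.2 hk))).exists
    have hsub : ∀ x ∈ Icc y 0, x ∈ Ioo (-k) k := fun x hx =>
      ⟨hy0.1.trans_le hx.1, by linarith [hx.2]⟩
    refine hy.not_gt (pos_of_backward_growth (D := fun x => v (x + c) - u x)
      hy0.2.le (fun x hx => hD x (hsub x hx))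
      (fun x hx => hG x (hsub x hx)) (fun x hx => hg x (hsub x hx)) (fun x _ hx => ?_)
      (by simpa using hlt) hG0)
    exact sub_nonpos.2 (hA.le_iff_le.1 (sub_nonpos.1 hx))

theorem abs_deriv_mul_le (h : IsLargeSol1D A f ℓ v) (hv' : MonotoneOn (deriv v) (Ioo (-ℓ) ℓ))
    {x d M : ℝ} (hd : 0 < d) (hl : x - d ∈ Ioo (-ℓ) ℓ) (hr : x + d ∈ Ioo (-ℓ) ℓ)
    (hMl : v (x - d) ≤ M) (hMr : v (x + d) ≤ M) : |deriv v x| * d ≤ M := by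
  have hx : x ∈ Ioo (-ℓ) ℓ := ⟨by linarith [hl.1], by linarith [hr.2]⟩
  have hx0 := h.2.1 x hx
  obtain ⟨z, hz, hzeq⟩ := h.exists_slope hx hr (by linarith)
  obtain ⟨y, hy, hyeq⟩ := h.exists_slope hl hx (by linarith)
  have hz' := hv' hx ⟨hx.1.trans hz.1, hz.2.trans hr.2⟩ hz.1.le
  have hy' := hv' ⟨hl.1.trans hy.1, hy.2.trans hx.2⟩ hx hy.2.le
  rcases abs_cases (deriv v x) with ⟨he, _⟩ | ⟨he, _⟩ <;> rw [he] <;> nlinarith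

end IsLargeSol1D

/-- Under (A1) and (A2), the family `v_ℓ` of one-dimensional large solutions on
`(−ℓ,ℓ)` converges to `0` uniformly on every compact subset of `ℝ` as `ℓ → ∞`. -/
theorem stmt11 (A f F B Binv : ℝ → ℝ)
    (hA : ContDiff ℝ 1 A) (hAmono : Monotone A) (hA0 : A 0 = 0)
    (hA'pos : ∀ r > 0, 0 < deriv A r)
    (hf_cont : ContinuousOn f (Set.Ici 0)) (hf_mono : MonotoneOn f (Set.Ici 0))
    (hf0 : f 0 = 0) (hf_pos : ∀ r > (0:ℝ), 0 < f r) (hf_top : Tendsto f atTop atTop)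
    (hF : ∀ x, F x = ∫ t in (0:ℝ)..x, f t)
    (hB : ∀ x, B x = ∫ s in (0:ℝ)..x, deriv A s * s)
    (hBinv_left : ∀ x ≥ (0:ℝ), Binv (B x) = x)
    (hBinv_right : ∀ t ≥ (0:ℝ), B (Binv t) = t)
    -- (A1) Keller–Osserman condition
    (hKO : ∀ r > (0:ℝ), IntegrableOn (fun s => 1 / Binv (F s)) (Set.Ioi r))
    -- (A2) Osgood condition
    (hOsgood : ∀ r > (0:ℝ), ¬ IntegrableOn (fun s => 1 / Binv (F s)) (Set.Ioc 0 r))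
    (v : ℝ → ℝ → ℝ) (hv : ∀ ℓ > (0:ℝ), IsLargeSol1D A f ℓ (v ℓ)) :
    ∀ K : Set ℝ, IsCompact K → TendstoUniformlyOn (fun ℓ => v ℓ) 0 atTop K := by
  intro K hK
  have hf : ∀ r ≥ (0 : ℝ), 0 ≤ f r := fun r hr =>
    hf0.symm.le.trans (hf_mono (mem_Ici.2 le_rfl) hr hr)
  have h1 := hv 1 one_pos
  have hAs : StrictMono A := h1.strictMono_flux_function one_pos hAmono hf hf_pos
  set M := v 1 0
  have hM : 0 ≤ M := h1.2.1 0 ⟨by norm_num, by norm_num⟩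
  obtain ⟨R, hR⟩ := hK.isBounded.exists_norm_le
  rw [Metric.tendstoUniformlyOn_iff]
  intro ε hε
  have hη : 0 < f (ε / 2) := hf_pos _ (by linarith)
  obtain ⟨δ, hδ, hAδ⟩ := Metric.continuousAt_iff.1 (hA.continuous.continuousAt (x := 0))
    (f (ε / 2) / 2) (by linarith)
  obtain ⟨d, hd, hdδ, hdε⟩ : ∃ d > 0, M < δ * d ∧ M < ε / 2 * d := by
    refine ⟨M / δ + M / (ε / 2) + 1, by positivity, ?_, ?_⟩
    · have : δ * (M / δ + M / (ε / 2) + 1) = M + δ * (M / (ε / 2) + 1) := by field_simp; ring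
      have : 0 < δ * (M / (ε / 2) + 1) := by positivity
      linarith
    · have : ε / 2 * (M / δ + M / (ε / 2) + 1) = M + ε / 2 * (M / δ + 1) := by field_simp; ring
      have : 0 < ε / 2 * (M / δ + 1) := by positivity
      linarith
  filter_upwards [eventually_gt_atTop (R + d + 2), eventually_gt_atTop 0] with ℓ hℓ hℓ0 x hxK
  have h := hv ℓ hℓ0
  obtain ⟨hx1, hx2⟩ := abs_le.1 (hR x hxK)
  have hmem : ∀ y ∈ Icc x (x + 1), y ∈ Ioo (-ℓ) ℓ := fun y hy =>
    ⟨by linarith [hy.1], by linarith [hy.2]⟩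
  have hderiv : ∀ y ∈ Icc x (x + 1), |deriv (v ℓ) y| < δ ∧ |deriv (v ℓ) y| < ε / 2 := by
    intro y hy
    have hle : |deriv (v ℓ) y| * d ≤ M := h.abs_deriv_mul_le (h.monotoneOn_deriv hAs hf) hd
      ⟨by linarith [hy.1], by linarith [hy.2]⟩ ⟨by linarith [hy.1], by linarith [hy.2]⟩
      (h.le_of_translate_subset h1 one_pos hAs hf_mono
        (abs_lt.2 ⟨by linarith [hy.1], by linarith [hy.2]⟩))
      (h.le_of_translate_subset h1 one_pos hAs hf_mono
        (abs_lt.2 ⟨by linarith [hy.1], by linarith [hy.2]⟩))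
    exact ⟨lt_of_mul_lt_mul_right (hle.trans_lt hdδ) hd.le,
      lt_of_mul_lt_mul_right (hle.trans_lt hdε) hd.le⟩
  have hxm : x ∈ Icc x (x + 1) := ⟨le_rfl, by linarith⟩
  have hxm' : x + 1 ∈ Icc x (x + 1) := ⟨by linarith, le_rfl⟩
  have hsmall : ∀ y ∈ Icc x (x + 1), |A (deriv (v ℓ) y)| < f (ε / 2) / 2 := fun y hy => by
    simpa [Real.dist_eq, hA0] using
      hAδ (x := deriv (v ℓ) y) (by simpa [Real.dist_eq] using (hderiv y hy).1)
  rw [Pi.zero_apply, dist_zero_left, Real.norm_eq_abs, abs_of_nonneg (h.2.1 x (hmem x hxm))]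
  by_contra! hge
  obtain ⟨z, hz, hzeq⟩ := h.exists_flux_slope (hmem x hxm) (hmem _ hxm') (by linarith)
  have hzm := hmem z (Ioo_subset_Icc_self hz)
  obtain ⟨y, hy, hyeq⟩ := h.exists_slope (hmem x hxm) hzm hz.1
  have hy' := (abs_lt.1 (hderiv y ⟨hy.1.le, (hy.2.trans hz.2).le⟩).2).1
  have hvz : ε / 2 ≤ v ℓ z := by nlinarith [hz.1, hz.2]
  have hfz := hf_mono (mem_Ici.2 (half_pos hε).le) (h.2.1 z hzm) hvz
  have h2 := (abs_lt.1 (hsmall x hxm)).1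
  have h3 := (abs_lt.1 (hsmall _ hxm')).2
  rw [add_sub_cancel_left, mul_one] at hzeq
  linarith
end
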